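/- arXiv:1904.08255 — 9 statements merged into one kernel-verified Lean document; each statement's English description precedes it below -/
import Mathlib

section
/- For every κ ≥ 1, the function f_κ is non-increasing on the interval [0,1]: for all θ₁, θ₂ ∈ [0,1] with θ₁ ≤ θ₂, f_κ(θ₂) ≤ f_κ(θ₁). -/
/-- The Wang–Wong function `f_κ`. -/
noncomputable def fWW (κ θ : ℝ) : ℝ :=
  ((1 + κ) / 2 - θ) ^ ((1 + κ) / (2 * κ)) * (θ + (κ - 1) / 2) ^ ((κ - 1) / (2 * κ))

/-- Increasing `b` and decreasing `a` by the same amount decreases the weighted geometric mean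
`a ^ p * b ^ q`, provided `q / b ≤ p / a`. -/
theorem rpow_sub_mul_rpow_add_le {p q a b d : ℝ} (hp : 0 ≤ p) (hq : 0 ≤ q) (hpq : p + q = 1)
    (ha : 0 < a) (hb : 0 < b) (hd : 0 ≤ d) (hda : d ≤ a) (h : q * a ≤ p * b) :
    (a - d) ^ p * (b + d) ^ q ≤ a ^ p * b ^ q := by
  have hx : 0 ≤ (a - d) / a := div_nonneg (sub_nonneg.2 hda) ha.le
  have hy : 0 ≤ (b + d) / b := by positivity
  have amgm := Real.geom_mean_le_arith_mean2_weighted hp hq hx hy hpq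
  have hle : p * ((a - d) / a) + q * ((b + d) / b) ≤ 1 := by
    have key : p * ((a - d) / a) + q * ((b + d) / b)
        = p + q - d * (p * b - q * a) / (a * b) := by
      field_simp
      ring
    have : 0 ≤ d * (p * b - q * a) / (a * b) :=
      div_nonneg (mul_nonneg hd (sub_nonneg.2 h)) (by positivity)
    linarith
  rw [Real.div_rpow (sub_nonneg.2 hda) ha.le, Real.div_rpow (by positivity) hb.le,
    div_mul_div_comm] at amgm
  exact (div_le_one (by positivity)).1 (amgm.trans hle)

/-- Observation 3.2: each `f_κ` is non-increasing on `[0,1]`. -/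
theorem fWW_antitoneOn (κ : ℝ) (hκ : 1 ≤ κ) :
    ∀ θ₁ ∈ Set.Icc (0 : ℝ) 1, ∀ θ₂ ∈ Set.Icc (0 : ℝ) 1, θ₁ ≤ θ₂ →
      fWW κ θ₂ ≤ fWW κ θ₁ := by
  rintro x ⟨hx0, hx1⟩ y ⟨hy0, hy1⟩ hxy
  rcases hκ.eq_or_lt with rfl | hκ
  · norm_num [fWW]
    linarith
  · have hκ0 : 0 < κ := by linarith
    have h := rpow_sub_mul_rpow_add_le (p := (1 + κ) / (2 * κ)) (q := (κ - 1) / (2 * κ))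
      (a := (1 + κ) / 2 - x) (b := x + (κ - 1) / 2) (d := y - x)
      (by positivity) (div_nonneg (by linarith) (by linarith)) (by field_simp; ring)
      (by linarith) (by linarith) (by linarith) (by linarith)
      (by
        rw [div_mul_eq_mul_div, div_mul_eq_mul_div]
        refine div_le_div_of_nonneg_right ?_ (by positivity)
        nlinarith [mul_nonneg hκ0.le hx0])
    unfold fWW
    convert h using 3 <;> ring
end

section
/- For every κ ≥ 1 and every θ ∈ [0,1], one has 1 + f_κ(1−θ) + ∫_θ^1 (1−t)/f_κ(t) dt = 1 + f_κ(0); that is, the function θ ↦ 1 + f_κ(1−θ) + ∫_θ^1 (1−t)/f_κ(t) dt is constant on [0,1] with value 1 + f_κ(0). -/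
theorem continuous_fWW {κ : ℝ} (hκ : 1 ≤ κ) : Continuous (fWW κ) := by
  have hp : 0 ≤ (1 + κ) / (2 * κ) := by positivity
  have hq : 0 ≤ (κ - 1) / (2 * κ) := div_nonneg (by linarith) (by linarith)
  exact ((continuous_const.sub continuous_id).rpow_const fun _ => Or.inr hp).mul
    ((continuous_id.add continuous_const).rpow_const fun _ => Or.inr hq)

theorem fWW_pos {κ t : ℝ} (hκ : 1 ≤ κ) (ht : t ∈ Set.Ioo (0 : ℝ) 1) : 0 < fWW κ t :=
  mul_pos (Real.rpow_pos_of_pos (by linarith [ht.2]) _)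
    (Real.rpow_pos_of_pos (by linarith [ht.1]) _)

theorem hasDerivAt_fWW_one_sub {κ t : ℝ} (hκ : 1 ≤ κ) (ht : t ∈ Set.Ioo (0 : ℝ) 1) :
    HasDerivAt (fun s => fWW κ (1 - s)) ((1 - t) / fWW κ t) t := by
  have hκ0 : κ ≠ 0 := by linarith
  have hx : 0 < (1 + κ) / 2 - t := by linarith [ht.2]
  have hy : 0 < t + (κ - 1) / 2 := by linarith [ht.1]
  have hreflect : (fun s => fWW κ (1 - s)) = fun s =>
      (s + (κ - 1) / 2) ^ ((1 + κ) / (2 * κ)) * ((1 + κ) / 2 - s) ^ ((κ - 1) / (2 * κ)) := by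
    funext s
    unfold fWW
    congr 2 <;> ring
  have hpq : (1 + κ) / (2 * κ) - 1 = -((κ - 1) / (2 * κ)) := by field_simp; ring
  have hqp : (κ - 1) / (2 * κ) - 1 = -((1 + κ) / (2 * κ)) := by field_simp; ring
  have hderiv := (((hasDerivAt_id t).add_const ((κ - 1) / 2)).rpow_const
    (p := (1 + κ) / (2 * κ)) (Or.inl hy.ne')).mul
    (((hasDerivAt_id t).const_sub ((1 + κ) / 2)).rpow_const
    (p := (κ - 1) / (2 * κ)) (Or.inl hx.ne'))
  rw [hreflect]
  refine hderiv.congr_deriv ?_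
  simp only [id]
  have hyp : (t + (κ - 1) / 2) ^ ((1 + κ) / (2 * κ)) =
      (t + (κ - 1) / 2) * ((t + (κ - 1) / 2) ^ ((κ - 1) / (2 * κ)))⁻¹ := by
    rw [← Real.rpow_neg hy.le, ← hpq, Real.rpow_sub_one hy.ne', ← mul_div_assoc,
      mul_div_cancel_left₀ _ hy.ne']
  have hxq : ((1 + κ) / 2 - t) ^ ((κ - 1) / (2 * κ)) =
      ((1 + κ) / 2 - t) * (((1 + κ) / 2 - t) ^ ((1 + κ) / (2 * κ)))⁻¹ := by
    rw [← Real.rpow_neg hx.le, ← hqp, Real.rpow_sub_one hx.ne', ← mul_div_assoc,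
      mul_div_cancel_left₀ _ hx.ne']
  rw [hpq, hqp, Real.rpow_neg hy.le, Real.rpow_neg hx.le, hyp, hxq, fWW, div_eq_mul_inv (1 - t),
    mul_inv]
  generalize (((1 + κ) / 2 - t) ^ ((1 + κ) / (2 * κ)))⁻¹ = u
  generalize ((t + (κ - 1) / 2) ^ ((κ - 1) / (2 * κ)))⁻¹ = v
  field_simp
  ring

/-- Equation (5): `θ ↦ 1 + f_κ(1−θ) + ∫_θ^1 (1−t)/f_κ(t) dt` is constant, equal to `1 + f_κ(0)`. -/
theorem fWW_betaStar_identity (κ : ℝ) (hκ : 1 ≤ κ) (θ : ℝ) (hθ : θ ∈ Set.Icc (0 : ℝ) 1) :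
    1 + fWW κ (1 - θ) + ∫ t in θ..1, (1 - t) / fWW κ t = 1 + fWW κ 0 := by
  have hcont : ContinuousOn (fun s => fWW κ (1 - s)) (Set.Icc θ 1) :=
    ((continuous_fWW hκ).comp (continuous_const.sub continuous_id)).continuousOn
  have hmem : ∀ t ∈ Set.Ioo θ 1, t ∈ Set.Ioo (0 : ℝ) 1 := fun t ht =>
    ⟨hθ.1.trans_lt ht.1, ht.2⟩
  have hderiv : ∀ t ∈ Set.Ioo θ 1,
      HasDerivAt (fun s => fWW κ (1 - s)) ((1 - t) / fWW κ t) t := fun t ht =>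
    hasDerivAt_fWW_one_sub hκ (hmem t ht)
  have hint : IntervalIntegrable (fun t => (1 - t) / fWW κ t) MeasureTheory.volume θ 1 :=
    (intervalIntegrable_iff_integrableOn_Ioc_of_le hθ.2).2 <|
      intervalIntegral.integrableOn_deriv_of_nonneg hcont hderiv fun t ht =>
        div_nonneg (by linarith [ht.2]) (fWW_pos hκ (hmem t ht)).le
  rw [intervalIntegral.integral_eq_sub_of_hasDerivAt_of_le hθ.2 hcont hderiv hint, sub_self]
  ring
end

section
/- For every κ ≥ 1 and every θ ∈ (0,1), the function f_κ is differentiable at θ with derivative f_κ'(θ) = −θ / f_κ(1−θ); equivalently, f_κ(1−θ) · f_κ'(θ) = −θ. -/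
/-- Derivative identity from Observation 3.2: `f_κ'(θ) = −θ / f_κ(1−θ)` on `(0,1)`. -/
theorem fWW_hasDerivAt (κ : ℝ) (hκ : 1 ≤ κ) (θ : ℝ) (hθ : θ ∈ Set.Ioo (0 : ℝ) 1) :
    HasDerivAt (fWW κ) (-θ / fWW κ (1 - θ)) θ := by
  obtain ⟨h0, h1⟩ := hθ
  have hκ0 : 0 < κ := by linarith
  have hA : 0 < (1 + κ) / 2 - θ := by linarith
  have hB : 0 < θ + (κ - 1) / 2 := by linarith
  have hdA : HasDerivAt (fun t : ℝ => ((1 + κ) / 2 - t) ^ ((1 + κ) / (2 * κ))) _ θ :=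
    ((hasDerivAt_id θ).const_sub ((1 + κ) / 2)).rpow_const (Or.inl hA.ne')
  have hdB : HasDerivAt (fun t : ℝ => (t + (κ - 1) / 2) ^ ((κ - 1) / (2 * κ))) _ θ :=
    ((hasDerivAt_id θ).add_const ((κ - 1) / 2)).rpow_const (Or.inl hB.ne')
  refine (hdA.mul hdB).congr_deriv ?_
  have hf : fWW κ (1 - θ) = (θ + (κ - 1) / 2) ^ ((1 + κ) / (2 * κ)) *
      ((1 + κ) / 2 - θ) ^ ((κ - 1) / (2 * κ)) := by
    rw [fWW]
    congr 2 <;> ring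
  have hp : (1 + κ) / (2 * κ) - 1 = -((κ - 1) / (2 * κ)) := by field_simp; ring
  have hq : (κ - 1) / (2 * κ) - 1 = -((1 + κ) / (2 * κ)) := by field_simp; ring
  have hAp : ((1 + κ) / 2 - θ) ^ ((1 + κ) / (2 * κ)) =
      ((1 + κ) / 2 - θ) * (((1 + κ) / 2 - θ) ^ ((κ - 1) / (2 * κ)))⁻¹ := by
    rw [← Real.rpow_neg hA.le, ← hp, mul_comm (_ - θ), ← Real.rpow_add_one hA.ne', sub_add_cancel]
  have hBq : (θ + (κ - 1) / 2) ^ ((κ - 1) / (2 * κ)) =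
      (θ + (κ - 1) / 2) * ((θ + (κ - 1) / 2) ^ ((1 + κ) / (2 * κ)))⁻¹ := by
    rw [← Real.rpow_neg hB.le, ← hq, mul_comm (θ + _), ← Real.rpow_add_one hB.ne', sub_add_cancel]
  simp only [id]
  rw [hf, hp, hq, Real.rpow_neg hA.le, Real.rpow_neg hB.le, hAp, hBq]
  have hX := Real.rpow_pos_of_pos hA ((κ - 1) / (2 * κ))
  have hY := Real.rpow_pos_of_pos hB ((1 + κ) / (2 * κ))
  generalize ((1 + κ) / 2 - θ) ^ ((κ - 1) / (2 * κ)) = X at hX ⊢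
  generalize (θ + (κ - 1) / 2) ^ ((1 + κ) / (2 * κ)) = Y at hY ⊢
  field_simp
  ring
end

section
/- There exists ε₀ ∈ (0,1) such that for every ε ∈ (0, ε₀) and every θ ∈ [0,1], f_{1+2ε}(θ) ≤ (1−θ)·(1 + ε·ln((θ+ε)/(1+ε−θ))) + 1.01·ε. -/
/-- With `A = 1 + ε - θ`, `B = θ + ε` and `α = ε / (1 + 2ε)`, `f_{1+2ε}` is `A (B / A) ^ α`. -/
theorem fWW_eq_mul_exp {ε θ : ℝ} (hε : 0 < ε) (hθ : θ ∈ Set.Icc (0 : ℝ) 1) :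
    fWW (1 + 2 * ε) θ =
      (1 + ε - θ) * Real.exp (ε / (1 + 2 * ε) * Real.log ((θ + ε) / (1 + ε - θ))) := by
  obtain ⟨h0, h1⟩ := hθ
  have hA : 0 < 1 + ε - θ := by linarith
  have hB : 0 < θ + ε := by linarith
  have hκ : 1 + 2 * ε ≠ 0 := by positivity
  have eA : (1 + (1 + 2 * ε)) / 2 - θ = 1 + ε - θ := by ring
  have eB : θ + (1 + 2 * ε - 1) / 2 = θ + ε := by ring
  have eα : (1 + (1 + 2 * ε)) / (2 * (1 + 2 * ε)) = 1 - ε / (1 + 2 * ε) := by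
    field_simp
    ring
  have eβ : (1 + 2 * ε - 1) / (2 * (1 + 2 * ε)) = ε / (1 + 2 * ε) := by
    field_simp
    ring
  rw [fWW, eA, eB, eα, eβ, Real.rpow_def_of_pos hA, Real.rpow_def_of_pos hB, ← Real.exp_add,
    Real.log_div hB.ne' hA.ne']
  conv_rhs => enter [1]; rw [← Real.exp_log hA]
  rw [← Real.exp_add]
  ring_nf

/-- The logarithmic ratio is largest in absolute value at the endpoints of `[0, 1]`. -/
theorem abs_log_add_div_sub_le {ε θ : ℝ} (hε : 0 < ε) (hθ : θ ∈ Set.Icc (0 : ℝ) 1) :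
    |Real.log ((θ + ε) / (1 + ε - θ))| ≤ Real.log ((1 + ε) / ε) := by
  obtain ⟨h0, h1⟩ := hθ
  have hA : 0 < 1 + ε - θ := by linarith
  have hB : 0 < θ + ε := by linarith
  rw [Real.log_div hB.ne' hA.ne', Real.log_div (by positivity) hε.ne', abs_le]
  have := Real.log_le_log hε (by linarith : ε ≤ θ + ε)
  have := Real.log_le_log hε (by linarith : ε ≤ 1 + ε - θ)
  have := Real.log_le_log hB (by linarith : θ + ε ≤ 1 + ε)
  have := Real.log_le_log hA (by linarith : 1 + ε - θ ≤ 1 + ε)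
  constructor <;> linarith

theorem sq_log_le_sixteen_mul_sqrt {z : ℝ} (hz : 1 ≤ z) : Real.log z ^ 2 ≤ 16 * √z := by
  have hlog : Real.log z ≤ 4 * √√z := by
    have h := Real.log_le_sub_one_of_pos (x := √√z) (by positivity)
    rw [Real.log_sqrt (by positivity), Real.log_sqrt (by positivity)] at h
    linarith
  calc Real.log z ^ 2 ≤ (4 * √√z) ^ 2 := by gcongr; exact Real.log_nonneg hz
    _ = 16 * √z := by rw [mul_pow, Real.sq_sqrt (by positivity)]; norm_num

theorem mul_sq_log_div_le {ε : ℝ} (hε : 0 < ε) (hε' : ε ≤ 1 / 10 ^ 8) :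
    ε * Real.log ((1 + ε) / ε) ^ 2 ≤ 1 / 500 := by
  have hz : 1 ≤ (1 + ε) / ε := by rw [le_div_iff₀ hε]; linarith
  have hs : √((1 + ε) / ε) * ε ≤ 1 / 8000 := by
    refine le_of_abs_le (abs_le_of_sq_le_sq ?_ (by norm_num))
    rw [mul_pow, Real.sq_sqrt (by positivity)]
    field_simp
    nlinarith
  nlinarith [sq_log_le_sixteen_mul_sqrt hz]

/-- Lemma C.1: Taylor-expansion upper bound on `f_{1+2ε}`. -/
theorem fWW_taylor_bound :
    ∃ ε₀ ∈ Set.Ioo (0 : ℝ) 1, ∀ ε ∈ Set.Ioo (0 : ℝ) ε₀, ∀ θ ∈ Set.Icc (0 : ℝ) 1,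
      fWW (1 + 2 * ε) θ
        ≤ (1 - θ) * (1 + ε * Real.log ((θ + ε) / (1 + ε - θ))) + 1.01 * ε := by
  refine ⟨1 / 10 ^ 8, by norm_num, fun ε ⟨hε, hε'⟩ θ hθ => ?_⟩
  rw [fWW_eq_mul_exp hε hθ]
  have hL := abs_log_add_div_sub_le hε hθ
  have hM := mul_sq_log_div_le hε hε'.le
  obtain ⟨h0, h1⟩ := hθ
  set L := Real.log ((θ + ε) / (1 + ε - θ))
  set M := Real.log ((1 + ε) / ε)
  obtain ⟨x, hx⟩ : ∃ x, x = ε / (1 + 2 * ε) * L := ⟨_, rfl⟩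
  rw [← hx]
  have hxL : ε * L = x + 2 * ε * x := by
    rw [hx]
    field_simp
  have hxM : |x| ≤ ε * M := by
    rw [hx, abs_mul, abs_of_pos (by positivity)]
    gcongr
    exact div_le_self hε.le (by linarith)
  have hsq : x ^ 2 ≤ ε / 500 :=
    calc x ^ 2 ≤ (ε * M) ^ 2 := sq_le_sq.2 (hxM.trans (le_abs_self _))
      _ = ε * (ε * M ^ 2) := by ring
      _ ≤ ε * (1 / 500) := by gcongr
      _ = ε / 500 := by ring
  have habs : |x| ≤ 1 / 1000 := abs_le_of_sq_le_sq (by linarith) (by norm_num)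
  have hexp : Real.exp x ≤ 1 + x + x ^ 2 := by
    have := (abs_le.1 (Real.abs_exp_sub_one_sub_id_le (habs.trans (by norm_num)))).2
    linarith
  obtain ⟨hx1, hx2⟩ := abs_le.1 habs
  have hlin : -(2 * ε * x) ≤ ε / 500 := by nlinarith
  have hquad : (1 - θ) * (x ^ 2 - 2 * ε * x) ≤ ε / 250 := by nlinarith
  have hrest : ε * (1 + x + x ^ 2) ≤ ε * (1 + 1 / 500) :=
    mul_le_mul_of_nonneg_left (by linarith) hε.le
  calc (1 + ε - θ) * Real.exp x ≤ (1 + ε - θ) * (1 + x + x ^ 2) := by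
        gcongr
        linarith
    _ = (1 - θ) * (1 + ε * L) + (1 - θ) * (x ^ 2 - 2 * ε * x) + ε * (1 + x + x ^ 2) := by
        rw [hxL]
        ring
    _ ≤ (1 - θ) * (1 + ε * L) + 1.01 * ε := by linarith
end

section
/- There exists ε₀ ∈ (0,1) such that for every ε ∈ (0, ε₀), one has 1 + f_{1+2ε}(0) ≤ 2 − ε. -/
theorem fWW_zero (ε : ℝ) :
    fWW (1 + 2 * ε) 0 = (1 + ε) ^ ((1 + ε) / (1 + 2 * ε)) * ε ^ (ε / (1 + 2 * ε)) := by
  have h₁ : (1 + (1 + 2 * ε)) / (2 * (1 + 2 * ε)) = (1 + ε) / (1 + 2 * ε) := by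
    rw [← mul_div_mul_left (1 + ε) (1 + 2 * ε) two_ne_zero]
    ring_nf
  have h₂ : (1 + 2 * ε - 1) / (2 * (1 + 2 * ε)) = ε / (1 + 2 * ε) := by
    rw [← mul_div_mul_left ε (1 + 2 * ε) two_ne_zero]
    ring_nf
  rw [fWW, h₁, h₂]
  congr 2 <;> ring

/-- Fact (beta-fine): for all sufficiently small `ε > 0`, `1 + f_{1+2ε}(0) ≤ 2 − ε`. -/
theorem betaStar_le :
    ∃ ε₀ ∈ Set.Ioo (0 : ℝ) 1, ∀ ε ∈ Set.Ioo (0 : ℝ) ε₀,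
      1 + fWW (1 + 2 * ε) 0 ≤ 2 - ε := by
  refine ⟨Real.exp (-6), ⟨Real.exp_pos _, Real.exp_lt_one_iff.2 (by norm_num)⟩, ?_⟩
  rintro ε ⟨hε, hlt⟩
  have hlog : Real.log ε < -6 := (Real.log_lt_iff_lt_exp hε).2 hlt
  have hsmall : ε ≤ 1 / 3 := by
    have h6 : (6 : ℝ) + 1 ≤ Real.exp 6 := Real.add_one_le_exp 6
    have hmul : Real.exp (-6) * Real.exp 6 = 1 := by rw [← Real.exp_add]; norm_num
    nlinarith [Real.exp_pos (-6)]
  have hfst : (1 + ε) ^ ((1 + ε) / (1 + 2 * ε)) ≤ 1 + ε :=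
    Real.rpow_le_self_of_one_le (by linarith) ((div_le_one (by linarith)).2 (by linarith))
  have hexp : ε / 2 ≤ ε / (1 + 2 * ε) := by gcongr; linarith
  have hsnd : ε ^ (ε / (1 + 2 * ε)) * (1 + 3 * ε) ≤ 1 := by
    calc ε ^ (ε / (1 + 2 * ε)) * (1 + 3 * ε)
        ≤ Real.exp (-(3 * ε)) * Real.exp (3 * ε) := by
          rw [Real.rpow_def_of_pos hε]
          gcongr
          · nlinarith
          · linarith [Real.add_one_le_exp (3 * ε)]
      _ = 1 := by rw [← Real.exp_add, neg_add_cancel, Real.exp_zero]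
  have hprod : (1 + ε) * ε ^ (ε / (1 + 2 * ε)) ≤ 1 - ε := by
    have hpos := Real.rpow_pos_of_pos hε (ε / (1 + 2 * ε))
    calc (1 + ε) * ε ^ (ε / (1 + 2 * ε))
        ≤ ((1 - ε) * (1 + 3 * ε)) * ε ^ (ε / (1 + 2 * ε)) := by gcongr; nlinarith
      _ = (1 - ε) * (ε ^ (ε / (1 + 2 * ε)) * (1 + 3 * ε)) := by ring
      _ ≤ 1 - ε := mul_le_of_le_one_right (by linarith) hsnd
  have hmul : (1 + ε) ^ ((1 + ε) / (1 + 2 * ε)) * ε ^ (ε / (1 + 2 * ε))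
      ≤ (1 + ε) * ε ^ (ε / (1 + 2 * ε)) := by gcongr
  rw [fWW_zero]
  linarith
end

section
/- There exists ε₀ ∈ (0,1) such that for every ε ∈ (0, ε₀) and every θ ∈ [0,1], f_{1+2ε}(θ) ≤ 1 − θ + √ε. -/
/-- Intermediate claim in Lemma 3.6(5): `f_{1+2ε}(θ) ≤ 1 − θ + √ε`. -/
theorem fWW_le_sub_add_sqrt :
    ∃ ε₀ ∈ Set.Ioo (0 : ℝ) 1, ∀ ε ∈ Set.Ioo (0 : ℝ) ε₀, ∀ θ ∈ Set.Icc (0 : ℝ) 1,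
      fWW (1 + 2 * ε) θ ≤ 1 - θ + Real.sqrt ε := by
  refine ⟨1 / 4, by norm_num, ?_⟩
  rintro ε ⟨hε, hε'⟩ θ ⟨hθ, hθ'⟩
  have hκ : (0 : ℝ) < 1 + 2 * ε := by linarith
  have hb : ε / (1 + 2 * ε) ≤ ε := div_le_self hε.le (by linarith)
  have hb' : 0 ≤ ε / (1 + 2 * ε) := by positivity
  have key := Real.geom_mean_le_arith_mean2_weighted
    (w₁ := (1 + ε) / (1 + 2 * ε)) (w₂ := ε / (1 + 2 * ε)) (p₁ := 1 + ε - θ) (p₂ := θ + ε)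
    (by positivity) hb' (by linarith) (by linarith) (by field_simp; ring)
  have ha : (1 + ε) / (1 + 2 * ε) = 1 - ε / (1 + 2 * ε) := by field_simp; ring
  have hf : fWW (1 + 2 * ε) θ =
      (1 + ε - θ) ^ ((1 + ε) / (1 + 2 * ε)) * (θ + ε) ^ (ε / (1 + 2 * ε)) := by
    unfold fWW
    congr 2
    · ring
    · field_simp; ring
    · ring
    · field_simp; ring
  have hs : 2 * ε ≤ Real.sqrt ε := Real.le_sqrt_of_sq_le (by nlinarith)
  rw [hf]
  refine key.trans ?_
  rw [ha]
  nlinarith [mul_nonneg hb' (sub_nonneg.2 hθ')]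
end

section
/- There exists ε₀ ∈ (0,1) such that for every ε ∈ (0, ε₀) and every θ ∈ [0, e^{−10}), f_{1+2ε}(θ) ≤ 1 − θ − 2ε. -/
/-- If `B ≤ e^{-c} A`, then the weighted geometric mean of `A` and `B` is at most `A / (1 + c q)`. -/
theorem rpow_mul_rpow_le_div {A B p q c : ℝ} (hA : 0 < A) (hB : 0 ≤ B) (hc : 0 ≤ c)
    (hq : 0 ≤ q) (hpq : p + q = 1) (hBA : B ≤ Real.exp (-c) * A) :
    A ^ p * B ^ q ≤ A / (1 + c * q) := by
  have hexp : Real.exp (-(c * q)) ≤ (1 + c * q)⁻¹ := by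
    rw [Real.exp_neg]
    exact inv_anti₀ (by positivity) (by linarith [Real.add_one_le_exp (c * q)])
  calc A ^ p * B ^ q ≤ A ^ p * (Real.exp (-c) * A) ^ q := by gcongr
    _ = A ^ (p + q) * Real.exp (-(c * q)) := by
      rw [Real.mul_rpow (Real.exp_pos _).le hA.le, ← Real.exp_mul, Real.rpow_add hA, neg_mul]
      ring
    _ ≤ A * (1 + c * q)⁻¹ := by
      rw [hpq, Real.rpow_one]
      gcongr
    _ = A / (1 + c * q) := (div_eq_mul_inv _ _).symm

/-- Intermediate claim in Lemma 3.6(5): for `θ < e^{−10}`, `f_{1+2ε}(θ) ≤ 1 − θ − 2ε`. -/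
theorem fWW_le_sub_sub :
    ∃ ε₀ ∈ Set.Ioo (0 : ℝ) 1, ∀ ε ∈ Set.Ioo (0 : ℝ) ε₀,
      ∀ θ ∈ Set.Ico (0 : ℝ) (Real.exp (-10)),
        fWW (1 + 2 * ε) θ ≤ 1 - θ - 2 * ε := by
  refine ⟨Real.exp (-10), ⟨Real.exp_pos _, by simp⟩, ?_⟩
  rintro ε ⟨hε, hε'⟩ θ ⟨hθ, hθ'⟩
  have h_small : Real.exp (-10) ≤ 1 / 30 := by
    have h : (2 : ℝ) ^ 10 ≤ Real.exp 10 := by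
      have h_pow : Real.exp 1 ^ 10 = Real.exp 10 := by simp
      rw [← h_pow]
      gcongr
      linarith [Real.add_one_le_exp (1 : ℝ)]
    rw [Real.exp_neg, one_div]
    exact inv_anti₀ (by norm_num) (by linarith)
  have h_ratio : 4 * Real.exp (-10) ≤ Real.exp (-8) := by
    have h : (2 : ℝ) ^ 2 ≤ Real.exp 2 := by
      have h_pow : Real.exp 1 ^ 2 = Real.exp 2 := by simp
      rw [← h_pow]
      gcongr
      linarith [Real.add_one_le_exp (1 : ℝ)]
    have h_split : Real.exp (-8) = Real.exp 2 * Real.exp (-10) := by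
      rw [← Real.exp_add]
      norm_num
    rw [h_split]
    gcongr
    linarith
  have h_bound : θ + ε ≤ Real.exp (-8) * (1 + ε - θ) := by
    nlinarith [Real.exp_pos (-8)]
  have key := rpow_mul_rpow_le_div (A := 1 + ε - θ) (B := θ + ε) (p := (1 + ε) / (1 + 2 * ε))
    (q := ε / (1 + 2 * ε)) (c := 8) (by linarith) (by positivity) (by norm_num) (by positivity)
    (by field_simp; ring) h_bound
  have h_eq : fWW (1 + 2 * ε) θ =
      (1 + ε - θ) ^ ((1 + ε) / (1 + 2 * ε)) * (θ + ε) ^ (ε / (1 + 2 * ε)) := by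
    unfold fWW
    congr 2
    · ring
    · field_simp
      ring
    · ring
    · field_simp
      ring
  rw [h_eq]
  refine key.trans ?_
  have h_den : 1 + 8 * (ε / (1 + 2 * ε)) = (1 + 10 * ε) / (1 + 2 * ε) := by
    field_simp
    ring
  rw [h_den, div_div_eq_mul_div, div_le_iff₀ (by positivity)]
  nlinarith
end

section
/- There exist constants C > 1 and ε₀ ∈ (0,1) such that for every ε ∈ (0, ε₀) and every θ ∈ [0,1], one has (2−ε) − θ − f_{1+2ε}(1−θ) > 0 and f_{1+2ε}(θ) + 1 − θ ≤ (1 + C·ε) · ((2−ε) − θ − f_{1+2ε}(1−θ)). -/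
theorem fWW_one_add_two_mul (ε θ : ℝ) :
    fWW (1 + 2 * ε) θ =
      (1 + ε - θ) ^ ((1 + ε) / (1 + 2 * ε)) * (θ + ε) ^ (ε / (1 + 2 * ε)) := by
  have h₁ : (1 + (1 + 2 * ε)) / 2 - θ = 1 + ε - θ := by ring
  have h₂ : θ + (1 + 2 * ε - 1) / 2 = θ + ε := by ring
  have h₃ : (1 + (1 + 2 * ε)) / (2 * (1 + 2 * ε)) = (1 + ε) / (1 + 2 * ε) := by
    rw [show 1 + (1 + 2 * ε) = 2 * (1 + ε) by ring, mul_div_mul_left _ _ two_ne_zero]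
  have h₄ : (1 + 2 * ε - 1) / (2 * (1 + 2 * ε)) = ε / (1 + 2 * ε) := by
    rw [show 1 + 2 * ε - 1 = 2 * ε by ring, mul_div_mul_left _ _ two_ne_zero]
  rw [fWW, h₁, h₂, h₃, h₄]

theorem rpow_one_sub_mul_rpow {u v : ℝ} (hu : 0 < u) (hv : 0 < v) (b : ℝ) :
    u ^ (1 - b) * v ^ b = u * Real.exp (b * Real.log (v / u)) := by
  rw [Real.rpow_def_of_pos hu, Real.rpow_def_of_pos hv, Real.log_div hv.ne' hu.ne', ← Real.exp_add]
  conv_rhs => rw [← Real.exp_log hu, Real.log_exp, ← Real.exp_add]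
  ring_nf

theorem log_le_two_mul_sqrt {y : ℝ} (hy : 0 < y) : Real.log y ≤ 2 * √y := by
  have h := Real.log_le_sub_one_of_pos (Real.sqrt_pos.2 hy)
  rw [Real.log_sqrt hy.le] at h
  linarith

theorem mul_exp_add_mul_exp_neg_le {u v x : ℝ} (hu : 0 ≤ u) (hv : 0 ≤ v) (hx : |x| ≤ 1) :
    u * Real.exp x + v * Real.exp (-x) ≤ u + v - x * (v - u) + x ^ 2 * (u + v) := by
  have h₁ := (abs_le.1 (Real.abs_exp_sub_one_sub_id_le hx)).2
  have h₂ := (abs_le.1 (Real.abs_exp_sub_one_sub_id_le (x := -x) (by rwa [abs_neg]))).2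
  nlinarith [mul_le_mul_of_nonneg_left h₁ hu, mul_le_mul_of_nonneg_left h₂ hv]

theorem rpow_mul_rpow_add_le_of_small {ε u v : ℝ} (hε : 0 < ε) (hε' : ε < 1 / 100000)
    (hεu : ε ≤ u) (hu : u ≤ 1 / 4096) (huv : u + v = 1 + 2 * ε) :
    u ^ (1 - ε / (1 + 2 * ε)) * v ^ (ε / (1 + 2 * ε)) +
      v ^ (1 - ε / (1 + 2 * ε)) * u ^ (ε / (1 + 2 * ε)) ≤ 1 - ε := by
  have hu₀ : 0 < u := by linarith
  have hv₀ : 0 < v := by linarith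
  set b := ε / (1 + 2 * ε)
  have hb₀ : 0 < b := by positivity
  have hb_mul : b * (1 + 2 * ε) = ε := div_mul_cancel₀ _ (by positivity)
  have hbε : b ≤ ε := by nlinarith
  have hneg : Real.log (u / v) = -Real.log (v / u) := by rw [← Real.log_inv, inv_div]
  rw [rpow_one_sub_mul_rpow hu₀ hv₀, rpow_one_sub_mul_rpow hv₀ hu₀, hneg, mul_neg]
  have hlower : 7 ≤ Real.log (v / u) := by
    have h : (2 : ℝ) ^ 11 ≤ v / u := by
      rw [le_div_iff₀ hu₀]
      linarith
    have h' := Real.log_le_log (by positivity) h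
    rw [Real.log_pow] at h'
    have := Real.log_two_gt_d9
    push_cast at h'
    linarith
  have hupper : ε * Real.log (v / u) ≤ 1 / 8 := by
    have h : v / u ≤ 2 / ε := div_le_div₀ zero_le_two (by linarith) hε hεu
    have h' : Real.log (v / u) ≤ 2 * √(2 / ε) :=
      (Real.log_le_log (by positivity) h).trans (log_le_two_mul_sqrt (by positivity))
    have h'' : ε * √(2 / ε) ≤ 1 / 16 := by
      refine abs_le_of_sq_le_sq' ?_ (by norm_num) |>.2
      rw [mul_pow, Real.sq_sqrt (by positivity), sq, mul_assoc, mul_div_cancel₀ _ hε.ne']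
      linarith
    nlinarith
  set M := Real.log (v / u)
  have hx₀ : 0 < b * M := by positivity
  have hx₁ : b * M ≤ 1 / 8 := by nlinarith
  have hx₂ : 6 * ε ≤ b * M := by nlinarith
  have hexp := mul_exp_add_mul_exp_neg_le hu₀.le hv₀.le
    (show |b * M| ≤ 1 by rw [abs_of_pos hx₀]; linarith)
  have hfactor : 1 / 2 ≤ v - u - b * M * (u + v) := by nlinarith
  have := mul_le_mul_of_nonneg_left hfactor hx₀.le
  nlinarith

/-- Analytic core of Lemma 3.6(2): the ratio is at most `1 + Cε` on all of `[0,1]`. -/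
theorem fWW_ratio_le_one_add :
    ∃ C : ℝ, 1 < C ∧ ∃ ε₀ ∈ Set.Ioo (0 : ℝ) 1,
      ∀ ε ∈ Set.Ioo (0 : ℝ) ε₀, ∀ θ ∈ Set.Icc (0 : ℝ) 1,
        0 < (2 - ε) - θ - fWW (1 + 2 * ε) (1 - θ) ∧
        fWW (1 + 2 * ε) θ + 1 - θ
          ≤ (1 + C * ε) * ((2 - ε) - θ - fWW (1 + 2 * ε) (1 - θ)) := by
  refine ⟨3 * 4096, by norm_num, 1 / 100000, by norm_num, ?_⟩
  rintro ε ⟨hε, hε'⟩ θ ⟨hθ, hθ'⟩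
  rw [fWW_one_add_two_mul, fWW_one_add_two_mul,
    show 1 + ε - (1 - θ) = θ + ε by ring, show 1 - θ + ε = 1 + ε - θ by ring,
    show (1 + ε) / (1 + 2 * ε) = 1 - ε / (1 + 2 * ε) by field_simp; ring]
  obtain ⟨u, hu⟩ : ∃ u, u = 1 + ε - θ := ⟨_, rfl⟩
  obtain ⟨v, hv⟩ : ∃ v, v = θ + ε := ⟨_, rfl⟩
  rw [← hu, ← hv]
  have hu₀ : 0 < u := by linarith
  have hv₀ : 0 < v := by linarith
  rcases le_total u (1 / 4096) with hsmall | hlarge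
  · have hsum := rpow_mul_rpow_add_le_of_small hε hε' (by linarith) hsmall
      (show u + v = 1 + 2 * ε by linarith)
    have hpos : 0 < u ^ (1 - ε / (1 + 2 * ε)) * v ^ (ε / (1 + 2 * ε)) := by positivity
    have hD : 0 < 2 - ε - θ - v ^ (1 - ε / (1 + 2 * ε)) * u ^ (ε / (1 + 2 * ε)) := by linarith
    exact ⟨hD, by nlinarith [mul_pos hε hD]⟩
  · set b := ε / (1 + 2 * ε)
    have hb₀ : 0 < b := by positivity
    have hb_mul : b * (1 + 2 * ε) = ε := div_mul_cancel₀ _ (by positivity)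
    have hbε : b ≤ ε := by nlinarith
    have h₁ := Real.geom_mean_le_arith_mean2_weighted (show 0 ≤ 1 - b by linarith) hb₀.le
      hu₀.le hv₀.le (sub_add_cancel 1 b)
    have h₂ := Real.geom_mean_le_arith_mean2_weighted (show 0 ≤ 1 - b by linarith) hb₀.le
      hv₀.le hu₀.le (sub_add_cancel 1 b)
    have hbu : b * u ≤ 2 * ε := by nlinarith
    have hbv : 0 ≤ b * v := by positivity
    have hD : 1 / 4096 ≤ 2 - ε - θ - v ^ (1 - b) * u ^ b := by linarith
    exact ⟨by linarith, by nlinarith [mul_le_mul_of_nonneg_left hD hε.le]⟩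
end

section
/- There exists ε₀ ∈ (0,1) such that for every ε ∈ (0, ε₀) and every c ∈ [0, 1/2], one has f_{1+2ε}(c) ≥ (1/2)·(1 + ε − c). -/
/-- A weighted geometric mean of `A` and `B` is at least `A / 2` when `A` is at most
`1 + 1 / b` times `B`, where `b` is the weight of `B`. -/
theorem half_mul_le_rpow_mul_rpow {A B a b : ℝ} (hA : 0 < A) (hB : 0 ≤ B) (hb : 0 < b)
    (hb1 : b ≤ 1) (hab : a + b = 1) (h : A ≤ B * (1 + 1 / b)) :
    (1 / 2) * A ≤ A ^ a * B ^ b := by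
  have hbern : 1 + 1 / b ≤ (2 : ℝ) ^ (1 / b) := by
    have := one_add_mul_self_le_rpow_one_add (s := (1 : ℝ)) (by norm_num)
      ((one_le_div hb).2 hb1)
    norm_num at this ⊢
    exact this
  have hAb : A ^ b ≤ B ^ b * 2 := by
    calc A ^ b ≤ (B * (2 : ℝ) ^ (1 / b)) ^ b :=
          Real.rpow_le_rpow hA.le (h.trans (mul_le_mul_of_nonneg_left hbern hB)) hb.le
      _ = B ^ b * 2 := by
          rw [Real.mul_rpow hB (by positivity), ← Real.rpow_mul (by norm_num),
            one_div_mul_cancel hb.ne', Real.rpow_one]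
  have hsplit : A ^ a * A ^ b = A := by
    rw [← Real.rpow_add hA, hab, Real.rpow_one]
  have := mul_le_mul_of_nonneg_left hAb (Real.rpow_nonneg hA.le a)
  linarith

/-- Intermediate claim in Lemma 3.6(3): `f_{1+2ε}(c) ≥ (1/2)(1+ε−c)` for `c ∈ [0,1/2]`. -/
theorem fWW_lower_bound :
    ∃ ε₀ ∈ Set.Ioo (0 : ℝ) 1, ∀ ε ∈ Set.Ioo (0 : ℝ) ε₀, ∀ c ∈ Set.Icc (0 : ℝ) (1 / 2),
      fWW (1 + 2 * ε) c ≥ (1 / 2) * (1 + ε - c) := by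
  refine ⟨1 / 2, by norm_num, fun ε ⟨hε, _⟩ c ⟨hc0, hc1⟩ => ?_⟩
  have hfWW : fWW (1 + 2 * ε) c =
      (1 + ε - c) ^ ((1 + ε) / (1 + 2 * ε)) * (c + ε) ^ (ε / (1 + 2 * ε)) := by
    unfold fWW
    congr 2
    · ring
    · field_simp
      ring
    · ring
    · field_simp
      ring
  rw [hfWW]
  refine half_mul_le_rpow_mul_rpow (by linarith) (by linarith) (by positivity) ?_ ?_ ?_
  · rw [div_le_one (by positivity)]
    linarith
  · field_simp
    ring
  · have hone : 1 + 1 / (ε / (1 + 2 * ε)) = 3 + 1 / ε := by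
      field_simp
      ring
    have hεε : ε * (1 / ε) = 1 := mul_one_div_cancel hε.ne'
    have hc : 0 ≤ c * (1 / ε) := by positivity
    rw [hone]
    linarith
end
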